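/- If a 3-dimensional simplicial complex on at most 6 vertices has at least two tetrahedra through each of its triangles (i.e., every 2-face lies in at least two 3-faces), then it contains a subcomplex which is a combinatorial 3-sphere. -/

import Mathlib

/- Formalization of definitions from:
   B. Bagchi, B. Datta, "Combinatorial triangulations of homology spheres". -/

open Finset

noncomputable section

attribute [local instance] Classical.propDecidable

namespace HomologySpheres

variable {V : Type*} [DecidableEq V] {W : Type*} [DecidableEq W]

/-- The vertex set of a finite family of finite sets. -/
def verts (K : Finset (Finset V)) : Finset V := K.sup id

/-- An (abstract, finite) simplicial complex: a nonempty collection of nonempty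
finite sets closed under taking nonempty subsets. -/
def IsComplex (K : Finset (Finset V)) : Prop :=
  K.Nonempty ∧ ∅ ∉ K ∧ ∀ s ∈ K, ∀ t : Finset V, t ⊆ s → t.Nonempty → t ∈ K

/-- The facets (maximal faces) of `K`. -/
def facets (K : Finset (Finset V)) : Finset (Finset V) :=
  K.filter fun s => ∀ t ∈ K, s ⊆ t → t = s

/-- `K` is pure of dimension `d`: every maximal face has `d + 1` vertices. -/
def IsPure (d : ℕ) (K : Finset (Finset V)) : Prop :=
  ∀ s ∈ facets K, s.card = d + 1

/-- The link of a face `σ` in `K`. -/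
def link (K : Finset (Finset V)) (σ : Finset V) : Finset (Finset V) :=
  K.filter fun τ => Disjoint τ σ ∧ τ ∪ σ ∈ K

/-- `L` is an induced (full) subcomplex of `K`. -/
def IsInduced (K L : Finset (Finset V)) : Prop :=
  L ⊆ K ∧ ∀ s ∈ K, s ⊆ verts L → s ∈ L

/-- The simplicial complement `C(L, K)`: the induced subcomplex of `K` on
`V(K) \ V(L)`. -/
def simpComplement (L K : Finset (Finset V)) : Finset (Finset V) :=
  K.filter fun s => s ⊆ verts K \ verts L

/-- The simplicial neighbourhood `N(L, K)`: the subcomplex of `K` whose maximal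
faces are the maximal faces of `K` meeting `V(L)`. -/
def simpNbhd (L K : Finset (Finset V)) : Finset (Finset V) :=
  K.filter fun s => ∃ t ∈ facets K, s ⊆ t ∧ (t ∩ verts L).Nonempty

/-- `fvec K i` is the number of `i`-dimensional faces of `K`. -/
def fvec (K : Finset (Finset V)) (i : ℕ) : ℕ :=
  (K.filter fun s => s.card = i + 1).card

/-- The number of facets of cardinality `d + 1` containing a given `(d-1)`-face
(the degree of the face in a (weak) pseudomanifold of dimension `d`). -/
def degOf (K : Finset (Finset V)) (d : ℕ) (s : Finset V) : ℕ :=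
  (K.filter fun t => s ⊆ t ∧ t.card = d + 1).card

/-- Simplicial isomorphism (via a vertex bijection carrying faces to faces). -/
def Iso (K : Finset (Finset V)) (L : Finset (Finset W)) : Prop :=
  ∃ f : V → W, Set.InjOn f ↑(verts K) ∧ L = K.image (Finset.image f)

/-- The join of two simplicial complexes (on disjoint vertex sets). -/
def sjoin (K L : Finset (Finset V)) : Finset (Finset V) :=
  K ∪ L ∪ (K ×ˢ L).image fun p => p.1 ∪ p.2

/-- The standard ball on vertex set `A`: all nonempty subsets of `A`. -/
def stdBall (A : Finset V) : Finset (Finset V) := A.powerset.erase ∅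

/-- The standard sphere on vertex set `A`: all nonempty proper subsets of `A`. -/
def stdSphere (A : Finset V) : Finset (Finset V) := (A.powerset.erase ∅).erase A

/-- `τ` is a free face of `K`, with `σ` the unique face properly containing it. -/
def IsFreeFace (K : Finset (Finset V)) (τ σ : Finset V) : Prop :=
  τ ∈ K ∧ σ ∈ K ∧ τ ⊂ σ ∧ ∀ ρ ∈ K, τ ⊂ ρ → ρ = σ

/-- An elementary collapse removes a free face together with the unique face
properly containing it. -/
def ElemCollapse (K K' : Finset (Finset V)) : Prop :=
  ∃ τ σ : Finset V, IsFreeFace K τ σ ∧ K' = (K.erase τ).erase σ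

/-- `K` collapses to `L` by a sequence of elementary collapses. -/
def CollapsesTo (K L : Finset (Finset V)) : Prop :=
  Relation.ReflTransGen ElemCollapse K L

/-- `K` is collapsible: it collapses to a single vertex. -/
def Collapsible (K : Finset (Finset V)) : Prop :=
  ∃ v : V, CollapsesTo K {{v}}

/-! ### Simplicial homology with `ℤ/2` coefficients (augmented chain complex).
A chain of level `n` is a `ZMod 2`-valued function supported on the faces of
cardinality `n` (the empty set, of cardinality `0`, serves as the `(-1)`-simplex
of the augmented complex).  Reduced homology in dimension `q` lives at level
`q + 1`. -/

/-- `c` is a chain of level `n` of `K` (over `ℤ/2`). -/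
def z2chainOK (K : Finset (Finset V)) (n : ℕ) (c : Finset V → ZMod 2) : Prop :=
  ∀ s : Finset V, c s ≠ 0 → s.card = n ∧ (s ∈ K ∨ s = ∅)

/-- The mod-2 boundary operator. -/
def z2bdry (K : Finset (Finset V)) (c : Finset V → ZMod 2) : Finset V → ZMod 2 :=
  fun t => ∑ v ∈ verts K \ t, c (insert v t)

/-- `K` is `ℤ/2`-acyclic: all reduced homology with `ℤ/2` coefficients vanishes,
i.e. in the augmented mod-2 chain complex every cycle is a boundary. -/
def Z2Acyclic (K : Finset (Finset V)) : Prop :=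
  ∀ (n : ℕ) (c : Finset V → ZMod 2), z2chainOK K n c → z2bdry K c = 0 →
    ∃ c', z2chainOK K (n + 1) c' ∧ z2bdry K c' = c

/-- `K` has the reduced `ℤ/2`-homology of the `d`-sphere: reduced homology
vanishes in all dimensions except `d` (level `d + 1`), where it is `ℤ/2`
(there is a cycle `z` which is not a boundary, and modulo boundaries every
cycle is `0` or `z`). -/
def Z2HomologySphere (d : ℕ) (K : Finset (Finset V)) : Prop :=
  (∀ (n : ℕ) (c : Finset V → ZMod 2), n ≠ d + 1 → z2chainOK K n c →
    z2bdry K c = 0 → ∃ c', z2chainOK K (n + 1) c' ∧ z2bdry K c' = c) ∧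
  (∃ z : Finset V → ZMod 2, z2chainOK K (d + 1) z ∧ z2bdry K z = 0 ∧
    (∀ c', z2chainOK K (d + 2) c' → z2bdry K c' ≠ z) ∧
    (∀ z', z2chainOK K (d + 1) z' → z2bdry K z' = 0 →
      (∃ c', z2chainOK K (d + 2) c' ∧ z2bdry K c' = z') ∨
      (∃ c', z2chainOK K (d + 2) c' ∧ z2bdry K c' = z + z')))

/-! ### Integral simplicial homology via ordered chains (Munkres §13: ordered
simplicial homology, allowing repeated vertices, agrees with simplicial
homology). An ordered `m`-tuple chain corresponds to dimension `m - 1`; the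
unique `0`-tuple is the `(-1)`-simplex of the augmented complex. -/

/-- `c` is an ordered chain of `K` over `ℤ`: supported on tuples whose image is
a face (the empty tuple being allowed in level `0`). -/
def zchainOK (K : Finset (Finset V)) {m : ℕ} (c : (Fin m → V) → ℤ) : Prop :=
  ∀ x : Fin m → V, c x ≠ 0 → (Finset.univ.image x ∈ K ∨ m = 0)

/-- The integral boundary operator on ordered chains. -/
def zbdry (K : Finset (Finset V)) {m : ℕ} (c : (Fin (m + 1) → V) → ℤ) :
    (Fin m → V) → ℤ :=
  fun y => ∑ i : Fin (m + 1), (-1 : ℤ) ^ (i : ℕ) * ∑ v ∈ verts K, c (i.insertNth v y)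

/-- `K` has the reduced integral homology of the `d`-sphere: reduced homology
vanishes in all dimensions except `d`, where it is infinite cyclic (there is a
cycle `z` such that every cycle is, modulo boundaries, a unique multiple of `z`). -/
def ZHomologySphere (d : ℕ) (K : Finset (Finset V)) : Prop :=
  (∀ c : (Fin 0 → V) → ℤ, ∃ c' : (Fin 1 → V) → ℤ, zchainOK K c' ∧ zbdry K c' = c) ∧
  (∀ (m : ℕ) (c : (Fin (m + 1) → V) → ℤ), m ≠ d → zchainOK K c → zbdry K c = 0 →
    ∃ c' : (Fin (m + 2) → V) → ℤ, zchainOK K c' ∧ zbdry K c' = c) ∧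
  (∃ z : (Fin (d + 1) → V) → ℤ, zchainOK K z ∧ zbdry K z = 0 ∧
    ∀ z' : (Fin (d + 1) → V) → ℤ, zchainOK K z' → zbdry K z' = 0 →
      ∃! k : ℤ, ∃ c'' : (Fin (d + 2) → V) → ℤ,
        zchainOK K c'' ∧ zbdry K c'' = z' - k • z)

/-- A weak pseudomanifold of dimension `d`: pure, and every `(d-1)`-face is in
exactly two facets. -/
def IsWeakPseudomanifold (d : ℕ) (K : Finset (Finset V)) : Prop :=
  IsComplex K ∧ IsPure d K ∧ ∀ s ∈ K, s.card = d → degOf K d s = 2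

/-- Adjacency of facets along a common `(d-1)`-face. -/
def FacetAdj (d : ℕ) (K : Finset (Finset V)) (s t : Finset V) : Prop :=
  s ∈ K ∧ t ∈ K ∧ s.card = d + 1 ∧ t.card = d + 1 ∧ (s ∩ t).card = d

/-- A pseudomanifold: a weak pseudomanifold in which any two facets are joined
by a chain of facets, consecutive ones sharing a `(d-1)`-face. -/
def IsPseudomanifold (d : ℕ) (K : Finset (Finset V)) : Prop :=
  IsWeakPseudomanifold d K ∧ ∀ s ∈ K, ∀ t ∈ K, s.card = d + 1 → t.card = d + 1 →
    Relation.ReflTransGen (FacetAdj d K) s t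

/-- A weak pseudomanifold with boundary. -/
def IsWeakPseudomanifoldWithBdry (d : ℕ) (K : Finset (Finset V)) : Prop :=
  IsComplex K ∧ IsPure d K ∧
  (∀ s ∈ K, s.card = d → degOf K d s = 1 ∨ degOf K d s = 2) ∧
  (∃ s ∈ K, s.card = d ∧ degOf K d s = 1)

/-- The boundary complex: all faces of degree-one `(d-1)`-faces. -/
def bdryComplex (d : ℕ) (K : Finset (Finset V)) : Finset (Finset V) :=
  K.filter fun t => ∃ s ∈ K, t ⊆ s ∧ s.card = d ∧ degOf K d s = 1

/-- `K` is connected (any two vertices joined by a path of edges). -/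
def SConnected (K : Finset (Finset V)) : Prop :=
  ∀ u ∈ verts K, ∀ v ∈ verts K,
    Relation.ReflTransGen (fun a b : V => ({a, b} : Finset V) ∈ K) u v

/-! ### Geometric realizations, subdivisions and combinatorial equivalence. -/

/-- A geometric simplicial complex in `ℝ^ℕ`: finitely many geometric simplices
(affinely independent vertex sets), closed under faces, any two of which meet
in a common face. -/
structure GComplex where
  faces : Finset (Finset (ℕ → ℝ))
  nonempty : faces.Nonempty
  empty_not_mem : ∅ ∉ faces
  down_closed : ∀ s ∈ faces, ∀ t : Finset (ℕ → ℝ), t ⊆ s → t.Nonempty → t ∈ faces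
  indep : ∀ s ∈ faces,
    AffineIndependent ℝ (fun x : {y : ℕ → ℝ // y ∈ s} => (x : ℕ → ℝ))
  glue : ∀ s ∈ faces, ∀ t ∈ faces,
    convexHull ℝ (s : Set (ℕ → ℝ)) ∩ convexHull ℝ (t : Set (ℕ → ℝ)) =
      convexHull ℝ ((s ∩ t : Finset (ℕ → ℝ)) : Set (ℕ → ℝ))

/-- The geometric carrier (underlying polyhedron) of a geometric complex. -/
def GComplex.carrier (G : GComplex) : Set (ℕ → ℝ) :=
  ⋃ s ∈ G.faces, convexHull ℝ (s : Set (ℕ → ℝ))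

/-- `G` realizes the abstract complex `K` via the vertex map `f`. -/
def RealizesMap (G : GComplex) (K : Finset (Finset V)) (f : V → ℕ → ℝ) : Prop :=
  Set.InjOn f ↑(verts K) ∧ G.faces = K.image (Finset.image f)

/-- `G` is a geometric realization of the abstract complex `K`. -/
def Realizes (G : GComplex) (K : Finset (Finset V)) : Prop :=
  ∃ f : V → ℕ → ℝ, RealizesMap G K f

/-- `G'` is a subdivision of `G`: same carrier, and every simplex of `G'` is
contained in a simplex of `G`. -/
def Subdivides (G' G : GComplex) : Prop :=
  G'.carrier = G.carrier ∧
  ∀ s ∈ G'.faces, ∃ t ∈ G.faces,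
    convexHull ℝ (s : Set (ℕ → ℝ)) ⊆ convexHull ℝ (t : Set (ℕ → ℝ))

/-- Combinatorial equivalence: `K` and `L` admit isomorphic subdivisions. -/
def CombEquiv (K : Finset (Finset V)) (L : Finset (Finset W)) : Prop :=
  ∃ G1 G1' G2 G2' : GComplex, Realizes G1 K ∧ Realizes G2 L ∧
    Subdivides G1' G1 ∧ Subdivides G2' G2 ∧ Iso G1'.faces G2'.faces

/-- A combinatorial `d`-ball: combinatorially equivalent to the standard ball. -/
def IsCombBall (d : ℕ) (K : Finset (Finset V)) : Prop :=
  ∃ A : Finset ℕ, A.card = d + 1 ∧ CombEquiv K (stdBall A)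

/-- A combinatorial `d`-sphere: combinatorially equivalent to the standard sphere. -/
def IsCombSphere (d : ℕ) (K : Finset (Finset V)) : Prop :=
  ∃ A : Finset ℕ, A.card = d + 2 ∧ CombEquiv K (stdSphere A)

/-- A combinatorial `d`-manifold: every vertex link is a combinatorial
`(d-1)`-sphere. -/
def IsCombManifold (d : ℕ) (K : Finset (Finset V)) : Prop :=
  IsComplex K ∧ ∀ v ∈ verts K, IsCombSphere (d - 1) (link K {v})

/-- A combinatorial `d`-manifold with boundary. -/
def IsCombManifoldWithBdry (d : ℕ) (K : Finset (Finset V)) : Prop :=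
  IsComplex K ∧
  (∀ v ∈ verts K, IsCombSphere (d - 1) (link K {v}) ∨
    IsCombBall (d - 1) (link K {v})) ∧
  (∃ v ∈ verts K, IsCombBall (d - 1) (link K {v}))

/-- A pl `k`-ball: a polyhedron carried by some geometric complex whose face
structure is a combinatorial `k`-ball. -/
def IsPLBall (k : ℕ) (P : Set (ℕ → ℝ)) : Prop :=
  ∃ G : GComplex, G.carrier = P ∧ IsCombBall k G.faces

/-- Elementary polyhedral collapse: `P = P' ∪ B` with `B` a pl `k`-ball and
`P' ∩ B` a pl `(k-1)`-ball. -/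
def PolyElemCollapse (P P' : Set (ℕ → ℝ)) : Prop :=
  ∃ k : ℕ, 1 ≤ k ∧ ∃ B : Set (ℕ → ℝ),
    IsPLBall k B ∧ P = P' ∪ B ∧ IsPLBall (k - 1) (P' ∩ B)

/-- Polyhedral collapse. -/
def PolyCollapsesTo (P Q : Set (ℕ → ℝ)) : Prop :=
  Relation.ReflTransGen PolyElemCollapse P Q

/-- Carrier of a subcomplex under a vertex realization map `f`. -/
def subCarrier (f : V → ℕ → ℝ) (L : Finset (Finset V)) : Set (ℕ → ℝ) :=
  ⋃ s ∈ L, convexHull ℝ ((s.image f : Finset (ℕ → ℝ)) : Set (ℕ → ℝ))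

/-! ### Bistellar moves. -/

/-- The core `β = {x ∈ A : A \ {x} ∈ X}` of a `(d+2)`-set `A`. -/
def bcore (X : Finset (Finset V)) (A : Finset V) : Finset V :=
  A.filter fun x => A.erase x ∈ X

/-- `κ_A` is a bistellar `i`-move on the `d`-dimensional complex `X`:
`A` has `d + 2` elements and contains at least one and at most `d + 1` facets
of `X`; with `β` the core of `A` and `α = A \ β` an `i`-face of `X`, one has
`β ∉ X`, and either `α` is a facet of `X` or `Lk_X(α)` has vertex set `β`. -/
def BistellarIMove (d i : ℕ) (X : Finset (Finset V)) (A : Finset V) : Prop :=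
  A.card = d + 2 ∧
  0 < ((facets X).filter fun σ => σ ⊆ A).card ∧
  ((facets X).filter fun σ => σ ⊆ A).card ≤ d + 1 ∧
  bcore X A ∉ X ∧
  A \ bcore X A ∈ X ∧ (A \ bcore X A).card = i + 1 ∧
  (A \ bcore X A ∈ facets X ∨ verts (link X (A \ bcore X A)) = bcore X A)

/-! ### The explicit small complexes of the paper. -/

/-- The complex generated by a list of facets: all nonempty subsets thereof. -/
def genBy (F : Finset (Finset ℕ)) : Finset (Finset ℕ) :=
  F.sup fun s => s.powerset.erase ∅

/-- The standard 2-sphere `S²₄`. -/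
def S24 : Finset (Finset ℕ) := stdSphere {1, 2, 3, 4}

/-- The join `S¹₃ * S⁰₂`. -/
def S13S02 : Finset (Finset ℕ) := sjoin (stdSphere {1, 2, 3}) (stdSphere {4, 5})

/-- The octahedron `S⁰₂ * S⁰₂ * S⁰₂`. -/
def Octa : Finset (Finset ℕ) :=
  sjoin (stdSphere {1, 2}) (sjoin (stdSphere {3, 4}) (stdSphere {5, 6}))

/-- The 6-vertex real projective plane `ℝP²₆`. -/
def RP26 : Finset (Finset ℕ) :=
  genBy {{1, 2, 3}, {1, 2, 4}, {1, 3, 5}, {1, 4, 6}, {1, 5, 6},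
         {2, 3, 6}, {2, 4, 5}, {2, 5, 6}, {3, 4, 5}, {3, 4, 6}}

/-- `Σ₁`: the 6-vertex 2-sphere with a vertex of degree 3 and one of degree 5. -/
def Sigma1 : Finset (Finset ℕ) :=
  genBy {{1, 2, 5}, {1, 2, 6}, {1, 5, 6}, {2, 3, 5},
         {2, 3, 6}, {3, 4, 5}, {3, 4, 6}, {4, 5, 6}}

/-- The double pyramid `S¹₅ * S⁰₂`. -/
def S15S02 : Finset (Finset ℕ) :=
  sjoin (genBy {{1, 2}, {2, 3}, {3, 4}, {4, 5}, {1, 5}}) (stdSphere {6, 7})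

/-- `Σ₂` (7-vertex 2-sphere with 10 triangles). -/
def Sigma2 : Finset (Finset ℕ) :=
  genBy {{1, 2, 6}, {1, 2, 7}, {1, 6, 7}, {2, 3, 6}, {2, 3, 7},
         {3, 4, 6}, {3, 4, 7}, {4, 5, 6}, {4, 5, 7}, {5, 6, 7}}

/-- `Σ₃` (7-vertex 2-sphere with 10 triangles). -/
def Sigma3 : Finset (Finset ℕ) :=
  genBy {{1, 2, 6}, {1, 2, 7}, {1, 6, 7}, {2, 3, 4}, {2, 3, 7},
         {2, 4, 6}, {3, 4, 7}, {4, 5, 6}, {4, 5, 7}, {5, 6, 7}}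

/-- `Σ₄` (7-vertex 2-sphere with 10 triangles). -/
def Sigma4 : Finset (Finset ℕ) :=
  genBy {{1, 2, 4}, {1, 2, 7}, {1, 4, 5}, {1, 5, 6}, {1, 6, 7},
         {2, 3, 4}, {2, 3, 7}, {3, 4, 7}, {4, 5, 7}, {5, 6, 7}}

/-- `Σ₅` (7-vertex 2-sphere with 10 triangles). -/
def Sigma5 : Finset (Finset ℕ) :=
  genBy {{1, 2, 3}, {1, 2, 6}, {1, 3, 5}, {1, 5, 6}, {2, 3, 4},
         {2, 4, 6}, {3, 4, 5}, {4, 5, 7}, {4, 6, 7}, {5, 6, 7}}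

/-- `Υ₁ = S²₄ ∪ S²₄`: two tetrahedral spheres sharing exactly one vertex. -/
def Upsilon1 : Finset (Finset ℕ) :=
  stdSphere {1, 2, 3, 7} ∪ stdSphere {4, 5, 6, 7}

/-- `Υ₂ = S²₄ ∪ (S⁰₂ * S¹₃)`: a tetrahedral sphere and a join, where the two
common vertices span an edge of the `S²₄`. -/
def Upsilon2 : Finset (Finset ℕ) :=
  stdSphere {4, 5, 6, 7} ∪ sjoin (stdSphere {6, 7}) (stdSphere {1, 2, 3})

/-- The complex `R` obtained from `ℝP²₆` by the generalized bistellar 1-move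
`κ_A`, `A = {1, 2, 5, 6}` (all such choices of `A` yield isomorphic complexes). -/
def Rcomplex : Finset (Finset ℕ) :=
  genBy {{1, 2, 3}, {1, 2, 4}, {1, 2, 5}, {1, 2, 6}, {1, 3, 5},
         {1, 4, 6}, {2, 3, 6}, {2, 4, 5}, {3, 4, 5}, {3, 4, 6}}


/-! ### Helper lemmas: geometric realization from barycentric coordinate functions -/

/-- `w` is a system of barycentric weights supported on `s`. -/
def IsWeight (s : Finset V) (w : V → ℝ) : Prop :=
  (∀ i, 0 ≤ w i) ∧ (∀ i, i ∉ s → w i = 0) ∧ ∑ i ∈ s, w i = 1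

/-- `φ` recovers barycentric coordinates on every face of `K` mapped by `f`. -/
def Coord (K : Finset (Finset V)) (f : V → ℕ → ℝ) (φ : (ℕ → ℝ) → V → ℝ) : Prop :=
  ∀ s ∈ K, ∀ w : V → ℝ, IsWeight s w → φ (∑ i ∈ s, w i • f i) = w

theorem mem_verts {K : Finset (Finset V)} {v : V} : v ∈ verts K ↔ ∃ s ∈ K, v ∈ s := by
  simp [verts, Finset.mem_sup]

theorem hull_of_weight {s : Finset V} {f : V → ℕ → ℝ} {w : V → ℝ} (hw : IsWeight s w) :
    ∑ i ∈ s, w i • f i ∈ convexHull ℝ ((s.image f : Finset (ℕ → ℝ)) : Set (ℕ → ℝ)) := by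
  refine (convex_convexHull ℝ _).sum_mem (fun i _ => hw.1 i) hw.2.2 (fun i hi => ?_)
  apply subset_convexHull
  simp only [Finset.coe_image]
  exact ⟨i, hi, rfl⟩

theorem weight_of_hull {s : Finset V} {f : V → ℕ → ℝ} (hf : Set.InjOn f ↑s) {x : ℕ → ℝ}
    (hx : x ∈ convexHull ℝ ((s.image f : Finset (ℕ → ℝ)) : Set (ℕ → ℝ))) :
    ∃ w, IsWeight s w ∧ ∑ i ∈ s, w i • f i = x := by
  rw [Finset.mem_convexHull'] at hx
  obtain ⟨w, h0, h1, h2⟩ := hx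
  rw [Finset.sum_image hf] at h1 h2
  refine ⟨fun i => if i ∈ s then w (f i) else 0, ⟨fun i => ?_, fun i hi => by simp [hi], ?_⟩, ?_⟩
  · dsimp only
    split_ifs with h
    · exact h0 _ (Finset.mem_image_of_mem f h)
    · exact le_rfl
  · rw [← h1]
    exact Finset.sum_congr rfl fun i hi => by simp [hi]
  · rw [← h2]
    exact Finset.sum_congr rfl fun i hi => by simp [hi]

theorem coord_injOn {K : Finset (Finset V)} (hK : IsComplex K) {f : V → ℕ → ℝ}
    {φ : (ℕ → ℝ) → V → ℝ} (H : Coord K f φ) : Set.InjOn f ↑(verts K) := by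
  have key : ∀ u ∈ verts K, φ (f u) = Pi.single u 1 := by
    intro u hu
    obtain ⟨s, hs, hus⟩ := mem_verts.1 hu
    have h1 : ({u} : Finset V) ∈ K :=
      hK.2.2 s hs _ (Finset.singleton_subset_iff.2 hus) (Finset.singleton_nonempty u)
    have := H {u} h1 (Pi.single u 1) ⟨fun i => ?_, fun i hi => ?_, by simp⟩
    · simpa using this
    · by_cases h : i = u
      · subst h; simp
      · simp [h]
    · have : i ≠ u := by simpa using hi
      simp [this]
  intro u hu v hv huv
  have h1 := key u hu
  have h2 := key v hv
  rw [huv, h2] at h1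
  by_contra hne
  have := congrFun h1 u
  simp [hne] at this

theorem coord_unique {K : Finset (Finset V)} {f : V → ℕ → ℝ}
    {φ : (ℕ → ℝ) → V → ℝ} (H : Coord K f φ) {s : Finset V} (hs : s ∈ K) (hne : s.Nonempty)
    (u : V → ℝ) (h0 : ∑ i ∈ s, u i = 0) (h1 : ∑ i ∈ s, u i • f i = 0) :
    ∀ i ∈ s, u i = 0 := by
  have hc : (0 : ℝ) < s.card := by exact_mod_cast hne.card_pos
  have hS : 0 ≤ ∑ i ∈ s, |u i| := Finset.sum_nonneg fun i _ => abs_nonneg _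
  set S := ∑ i ∈ s, |u i| with hSdef
  set a : ℝ := (s.card : ℝ)⁻¹ with ha
  have hapos : 0 < a := inv_pos.2 hc
  have hca : (s.card : ℝ) * a = 1 := mul_inv_cancel₀ hc.ne'
  set e : ℝ := a / (1 + S) with he
  have hepos : 0 < e := by positivity
  have heS : e * (1 + S) = a := by rw [he]; field_simp
  have hw1 : IsWeight s (fun i => if i ∈ s then a else 0) := by
    refine ⟨fun i => ?_, fun i hi => by simp [hi], ?_⟩
    · dsimp only; split_ifs <;> linarith
    · rw [Finset.sum_congr rfl (fun i hi => if_pos hi)]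
      simpa using hca
  have hw2 : IsWeight s (fun i => if i ∈ s then a + e * u i else 0) := by
    refine ⟨fun i => ?_, fun i hi => by simp [hi], ?_⟩
    · dsimp only
      split_ifs with h
      · have h3 : |u i| ≤ S := Finset.single_le_sum (f := fun i => |u i|) (fun j _ => abs_nonneg _) h
        have h4 := neg_abs_le (u i)
        nlinarith
      · exact le_rfl
    · rw [Finset.sum_congr rfl (fun i hi => if_pos hi), Finset.sum_add_distrib,
        ← Finset.mul_sum, h0]
      simpa using hca
  have e1 := H s hs _ hw1
  have e2 := H s hs _ hw2
  have e3 : ∑ i ∈ s, (if i ∈ s then a + e * u i else 0) • f i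
      = ∑ i ∈ s, (if i ∈ s then a else 0) • f i := by
    have : ∀ i ∈ s, (if i ∈ s then a + e * u i else 0) • f i
        = (if i ∈ s then a else 0) • f i + e • (u i • f i) := by
      intro i hi
      simp only [hi, if_true, add_smul, mul_smul]
    rw [Finset.sum_congr rfl this, Finset.sum_add_distrib, ← Finset.smul_sum, h1]
    simp
  rw [e3, e1] at e2
  intro i hi
  have := congrFun e2 i
  simp only [hi, if_true] at this
  have h5 : e * u i = 0 := by linarith
  rcases mul_eq_zero.1 h5 with h | h
  · exact absurd h hepos.ne'
  · exact h

/-- The geometric complex realizing `K` via `f`. -/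
def mkG (K : Finset (Finset V)) (hK : IsComplex K) (f : V → ℕ → ℝ)
    (φ : (ℕ → ℝ) → V → ℝ) (H : Coord K f φ) : GComplex where
  faces := K.image (Finset.image f)
  nonempty := hK.1.image _
  empty_not_mem := by
    intro h
    obtain ⟨s, hs, hse⟩ := Finset.mem_image.1 h
    rw [Finset.image_eq_empty] at hse
    exact hK.2.1 (hse ▸ hs)
  down_closed := by
    intro s hs t hts hne
    obtain ⟨s', hs', rfl⟩ := Finset.mem_image.1 hs
    obtain ⟨t', ht', rfl⟩ := Finset.subset_image_iff.1 hts
    exact Finset.mem_image_of_mem _ (hK.2.2 s' hs' t' (by exact_mod_cast ht') (Finset.image_nonempty.1 hne))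
  indep := by
    intro s hs
    obtain ⟨s', hs', rfl⟩ := Finset.mem_image.1 hs
    have hne : s'.Nonempty := Finset.nonempty_iff_ne_empty.2 (fun h => hK.2.1 (h ▸ hs'))
    have h1 : AffineIndependent ℝ (fun i : {i // i ∈ s'} => f i) := by
      rw [affineIndependent_iff]
      intro t w h0 h1 i hi
      set u : V → ℝ := fun v => if h : v ∈ s' then (if (⟨v, h⟩ : {i // i ∈ s'}) ∈ t then w ⟨v, h⟩ else 0) else 0 with hu
      have hat : s'.attach ∩ t = t := Finset.inter_eq_right.2 fun x _ => Finset.mem_attach _ _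
      have hu' : ∀ j : {i // i ∈ s'}, u j = if j ∈ t then w j else 0 := by
        intro j
        simp [hu, j.2]
      have := coord_unique H hs' hne u ?_ ?_ i i.2
      · rw [hu'] at this
        simpa [hi] using this
      · rw [← Finset.sum_attach]
        simp only [hu']
        rw [Finset.sum_ite_mem, hat]
        exact h0
      · rw [← Finset.sum_attach]
        simp only [hu']
        rw [← h1]
        simp only [ite_smul, zero_smul]
        rw [Finset.sum_ite_mem, hat]
    refine h1.range.mono (s := ((s'.image f : Finset (ℕ → ℝ)) : Set (ℕ → ℝ))) ?_
    intro y hy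
    simp only [Finset.coe_image] at hy
    obtain ⟨i, hi, rfl⟩ := hy
    exact ⟨⟨i, hi⟩, rfl⟩
  glue := by
    intro s hs t ht
    obtain ⟨s, hs', rfl⟩ := Finset.mem_image.1 hs
    obtain ⟨t, ht', rfl⟩ := Finset.mem_image.1 ht
    have hinj := coord_injOn hK H
    have hsv : (↑s : Set V) ⊆ ↑(verts K) := fun v hv => mem_verts.2 ⟨s, hs', hv⟩
    have htv : (↑t : Set V) ⊆ ↑(verts K) := fun v hv => mem_verts.2 ⟨t, ht', hv⟩
    apply Set.Subset.antisymm
    · rintro x ⟨hx1, hx2⟩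
      obtain ⟨w, hw, hwx⟩ := weight_of_hull (hinj.mono hsv) hx1
      obtain ⟨w', hw', hwx'⟩ := weight_of_hull (hinj.mono htv) hx2
      have e1 := H s hs' w hw
      have e2 := H t ht' w' hw'
      rw [hwx] at e1
      rw [hwx', e1] at e2
      subst e2
      have hz : ∀ i ∈ s, i ∉ s ∩ t → w i = 0 := by
        intro i hi hit
        exact hw'.2.1 i (fun h => hit (Finset.mem_inter.2 ⟨hi, h⟩))
      have hW : IsWeight (s ∩ t) w := by
        refine ⟨hw.1, fun i hi => ?_, ?_⟩
        · by_cases his : i ∈ s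
          · exact hz i his hi
          · exact hw.2.1 i his
        · rw [Finset.sum_subset Finset.inter_subset_left hz]; exact hw.2.2
      have hm := hull_of_weight (f := f) hW
      rw [Finset.sum_subset Finset.inter_subset_left
        (fun i hi hit => by rw [hz i hi hit, zero_smul]), hwx] at hm
      refine convexHull_mono ?_ hm
      exact_mod_cast Finset.image_inter_subset f s t
    · apply Set.subset_inter
      · exact convexHull_mono (by exact_mod_cast Finset.inter_subset_left)
      · exact convexHull_mono (by exact_mod_cast Finset.inter_subset_right)

theorem mkG_realizes (K : Finset (Finset V)) (hK : IsComplex K) (f : V → ℕ → ℝ)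
    (φ : (ℕ → ℝ) → V → ℝ) (H : Coord K f φ) : RealizesMap (mkG K hK f φ H) K f :=
  ⟨coord_injOn hK H, rfl⟩

/-- The join of the boundaries of two simplices with disjoint vertex sets `A`, `B`. -/
def bjoin (A B : Finset V) : Finset (Finset V) :=
  (A ∪ B).powerset.filter fun s => s.Nonempty ∧ ¬ A ⊆ s ∧ ¬ B ⊆ s

theorem mem_bjoin {A B s : Finset V} :
    s ∈ bjoin A B ↔ s ⊆ A ∪ B ∧ s.Nonempty ∧ ¬ A ⊆ s ∧ ¬ B ⊆ s := by
  rw [bjoin, Finset.mem_filter, Finset.mem_powerset]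

theorem bjoin_isComplex {A B : Finset V} (hA : A.Nonempty) (hB : 2 ≤ B.card)
    (hAB : Disjoint A B) : IsComplex (bjoin A B) := by
  refine ⟨?_, ?_, ?_⟩
  · have hBne : B.Nonempty := Finset.card_pos.1 (by omega)
    obtain ⟨b, hb⟩ := hBne
    refine ⟨{b}, mem_bjoin.2 ⟨?_, Finset.singleton_nonempty b, ?_, ?_⟩⟩
    · exact Finset.singleton_subset_iff.2 (Finset.mem_union_right _ hb)
    · intro h
      obtain ⟨a, ha⟩ := hA
      have : a = b := by simpa using h ha
      subst this
      exact Finset.disjoint_left.1 hAB ha hb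
    · intro h
      have := Finset.card_le_card h
      simp at this
      omega
  · intro h
    exact Finset.not_nonempty_empty (mem_bjoin.1 h).2.1
  · intro s hs t hts hne
    rw [mem_bjoin] at hs ⊢
    exact ⟨hts.trans hs.1, hne, fun h => hs.2.2.1 (h.trans hts), fun h => hs.2.2.2 (h.trans hts)⟩

theorem mem_stdSphere {A s : Finset V} :
    s ∈ stdSphere A ↔ s ⊆ A ∧ s.Nonempty ∧ s ≠ A := by
  simp only [stdSphere, Finset.mem_erase, Finset.mem_powerset, Finset.nonempty_iff_ne_empty]
  tauto

theorem stdSphere_isComplex {A : Finset V} (hA : 2 ≤ A.card) : IsComplex (stdSphere A) := by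
  refine ⟨?_, ?_, ?_⟩
  · obtain ⟨a, ha⟩ : A.Nonempty := Finset.card_pos.1 (by omega)
    refine ⟨{a}, mem_stdSphere.2 ⟨by simpa using ha, Finset.singleton_nonempty a, ?_⟩⟩
    intro h
    rw [← h] at hA
    simp at hA
  · intro h
    exact Finset.not_nonempty_empty (mem_stdSphere.1 h).2.1
  · intro s hs t hts hne
    rw [mem_stdSphere] at hs ⊢
    refine ⟨hts.trans hs.1, hne, ?_⟩
    rintro rfl
    exact hs.2.2 (Finset.Subset.antisymm hs.1 hts)

/-! ### The concrete realization -/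

/-- Vertices `0, …, 4` go to the standard basis, vertex `5` to the barycentre of `A`. -/
def fpos (A : Finset ℕ) (v : ℕ) : ℕ → ℝ := fun j =>
  if v = 5 then (if j ∈ A then (A.card : ℝ)⁻¹ else 0) else (if j = v then 1 else 0)

/-- The barycentric coordinates of the stellar subdivision. -/
def fcoord (A : Finset ℕ) (hA : A.Nonempty) (x : ℕ → ℝ) (v : ℕ) : ℝ :=
  if v = 5 then A.card * A.inf' hA x else if v ∈ A then x v - A.inf' hA x
    else if v < 5 then x v else 0

theorem comb_eq (A : Finset ℕ) (s : Finset ℕ) (hs : s ⊆ Finset.range 6) (w : ℕ → ℝ)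
    (hw : ∀ i, i ∉ s → w i = 0) (j : ℕ) :
    (∑ i ∈ s, w i • fpos A i) j
      = (if j < 5 then w j else 0) + w 5 * (if j ∈ A then (A.card : ℝ)⁻¹ else 0) := by
  rw [Finset.sum_subset hs (fun i _ hi => by rw [hw i hi, zero_smul]), Finset.sum_range_succ]
  have : ∀ i ∈ Finset.range 5, w i • fpos A i = fun j => if j = i then w i else 0 := by
    intro i hi
    have : i ≠ 5 := by have := Finset.mem_range.1 hi; omega
    funext k
    simp [fpos, this]
  rw [Finset.sum_congr rfl this]
  simp [fpos, Finset.sum_apply]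

theorem inf_eq {A : Finset ℕ} (hA : A.Nonempty) (x w : ℕ → ℝ) (c : ℝ)
    (h : ∀ j ∈ A, x j = w j + c) (h0 : ∀ j, 0 ≤ w j) (h1 : ∃ j ∈ A, w j = 0) :
    A.inf' hA x = c := by
  apply le_antisymm
  · obtain ⟨j, hj, hw⟩ := h1
    have := Finset.inf'_le x hj
    rw [h j hj, hw] at this
    linarith
  · apply Finset.le_inf'
    intro j hj
    rw [h j hj]
    linarith [h0 j]

theorem fcoord_ok (A : Finset ℕ) (hA : A.Nonempty) (hA5 : A ⊆ Finset.range 5) :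
    Coord (bjoin A (Finset.range 6 \ A)) (fpos A) (fcoord A hA) := by
  intro s hs w hw
  obtain ⟨hs6, -, hAs, -⟩ := mem_bjoin.1 hs
  have hs6 : s ⊆ Finset.range 6 := by
    refine hs6.trans (Finset.union_subset (hA5.trans ?_) Finset.sdiff_subset)
    exact Finset.range_subset_range.2 (by norm_num)
  have hx := comb_eq A s hs6 w hw.2.1
  set x := ∑ i ∈ s, w i • fpos A i with hxdef
  have hlt : ∀ j ∈ A, j < 5 := fun j hj => Finset.mem_range.1 (hA5 hj)
  have hc : (0 : ℝ) < A.card := by exact_mod_cast hA.card_pos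
  have hinf : A.inf' hA x = w 5 * (A.card : ℝ)⁻¹ := by
    apply inf_eq hA x w _ _ hw.1
    · obtain ⟨j, hj, hjs⟩ := Finset.not_subset.1 hAs
      exact ⟨j, hj, hw.2.1 j hjs⟩
    · intro j hj
      rw [hx]; simp [hj, hlt j hj]
  funext v
  unfold fcoord
  rw [hinf]
  split_ifs with h1 h2 h3
  · subst h1; field_simp
  · rw [hx]; simp [h2, hlt v h2]
  · rw [hx]; simp [h2, h3]
  · symm
    apply hw.2.1
    intro hv
    have := Finset.mem_range.1 (hs6 hv)
    omega

/-- Standard basis positions. -/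
def spos (v : ℕ) : ℕ → ℝ := fun j => if j = v then 1 else 0

theorem scomb_eq (s : Finset ℕ) (w : ℕ → ℝ) (hw : ∀ i, i ∉ s → w i = 0) :
    ∑ i ∈ s, w i • spos i = w := by
  funext j
  rw [Finset.sum_apply]
  by_cases hj : j ∈ s
  · simp [spos, hj]
  · simp [spos, hj, hw j hj]

theorem spos_ok : Coord (stdSphere (Finset.range 5)) spos (fun x => x) := by
  intro s _ w hw
  exact scomb_eq s w hw.2.1

theorem mkG_carrier (K : Finset (Finset V)) (hK : IsComplex K) (f : V → ℕ → ℝ)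
    (φ : (ℕ → ℝ) → V → ℝ) (H : Coord K f φ) (x : ℕ → ℝ) :
    x ∈ (mkG K hK f φ H).carrier ↔
      ∃ s ∈ K, x ∈ convexHull ℝ ((s.image f : Finset (ℕ → ℝ)) : Set (ℕ → ℝ)) := by
  simp only [GComplex.carrier, mkG, Set.mem_iUnion, Finset.mem_image]
  constructor
  · rintro ⟨t, ⟨s, hs, rfl⟩, hx⟩
    exact ⟨s, hs, hx⟩
  · rintro ⟨s, hs, hx⟩
    exact ⟨_, ⟨s, hs, rfl⟩, hx⟩

/-- Each simplex of the stellar subdivision lies in a simplex of the standard sphere. -/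
theorem sub_face (A : Finset ℕ) (hA : A.Nonempty) (hA5 : A ⊂ Finset.range 5) (s : Finset ℕ)
    (hs : s ∈ bjoin A (Finset.range 6 \ A)) :
    ∃ t ∈ stdSphere (Finset.range 5),
      convexHull ℝ ((s.image (fpos A) : Finset (ℕ → ℝ)) : Set (ℕ → ℝ)) ⊆
      convexHull ℝ ((t.image spos : Finset (ℕ → ℝ)) : Set (ℕ → ℝ)) := by
  obtain ⟨hsU, hne, hAs, hBs⟩ := mem_bjoin.1 hs
  have hlt : ∀ j ∈ A, j < 5 := fun j hj => Finset.mem_range.1 (hA5.1 hj)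
  have hs6 : ∀ j ∈ s, j < 6 := by
    intro j hj
    rcases Finset.mem_union.1 (hsU hj) with h | h
    · have := hlt j h; omega
    · exact Finset.mem_range.1 (Finset.mem_sdiff.1 h).1
  have hc : (0 : ℝ) < A.card := by exact_mod_cast hA.card_pos
  refine ⟨if 5 ∈ s then s.erase 5 ∪ A else s, mem_stdSphere.2 ⟨?_, ?_, ?_⟩, ?_⟩
  · split_ifs with h5
    · refine Finset.union_subset (fun j hj => ?_) hA5.1
      have h1 := Finset.mem_erase.1 hj
      have := hs6 j h1.2
      exact Finset.mem_range.2 (by omega)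
    · intro j hj
      have := hs6 j hj
      have : j ≠ 5 := fun h => h5 (h ▸ hj)
      exact Finset.mem_range.2 (by omega)
  · split_ifs with h5
    · exact hA.mono Finset.subset_union_right
    · exact hne
  · split_ifs with h5
    · intro h
      apply hBs
      intro j hj
      have hj' := Finset.mem_sdiff.1 hj
      by_cases hj5 : j = 5
      · rwa [hj5]
      · have : j ∈ Finset.range 5 := by
          have := Finset.mem_range.1 hj'.1
          exact Finset.mem_range.2 (by omega)
        rw [← h] at this
        rcases Finset.mem_union.1 this with h | h
        · exact (Finset.mem_erase.1 h).2
        · exact absurd h hj'.2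
    · intro h
      exact hAs (h ▸ hA5.1)
  · apply convexHull_min _ (convex_convexHull ℝ _)
    intro y hy
    simp only [Finset.coe_image] at hy
    obtain ⟨v, hv, rfl⟩ := hy
    have hv : v ∈ s := hv
    by_cases hv5 : v = 5
    · subst hv5
      rw [if_pos hv]
      have hw : IsWeight A (fun j => if j ∈ A then (A.card : ℝ)⁻¹ else 0) := by
        refine ⟨fun i => ?_, fun i hi => by simp [hi], ?_⟩
        · dsimp only; split_ifs
          · positivity
          · exact le_rfl
        · rw [Finset.sum_congr rfl (fun i hi => if_pos hi)]
          simp [hc.ne']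
      have := hull_of_weight (f := spos) hw
      rw [scomb_eq A _ hw.2.1] at this
      have e : fpos A 5 = fun j => if j ∈ A then (A.card : ℝ)⁻¹ else 0 := by
        funext j; simp [fpos]
      rw [e]
      refine convexHull_mono ?_ this
      exact_mod_cast Finset.image_subset_image Finset.subset_union_right
    · apply subset_convexHull
      have e : fpos A v = spos v := by funext j; simp [fpos, spos, hv5]
      rw [e]
      have : v ∈ (if 5 ∈ s then s.erase 5 ∪ A else s) := by
        split_ifs
        · exact Finset.mem_union_left _ (Finset.mem_erase.2 ⟨hv5, hv⟩)
        · exact hv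
      exact_mod_cast Finset.mem_image_of_mem spos this

theorem spos_inj : Function.Injective spos := by
  intro a b h
  have := congrFun h a
  simp [spos] at this
  exact this

theorem sup_face (A : Finset ℕ) (hA : A.Nonempty) (hA5 : A ⊂ Finset.range 5) (t : Finset ℕ)
    (ht : t ∈ stdSphere (Finset.range 5)) (x : ℕ → ℝ)
    (hx : x ∈ convexHull ℝ ((t.image spos : Finset (ℕ → ℝ)) : Set (ℕ → ℝ))) :
    ∃ s ∈ bjoin A (Finset.range 6 \ A),
      x ∈ convexHull ℝ ((s.image (fpos A) : Finset (ℕ → ℝ)) : Set (ℕ → ℝ)) := by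
  obtain ⟨w, hw, hwx⟩ := weight_of_hull spos_inj.injOn hx
  rw [scomb_eq t w hw.2.1] at hwx
  subst hwx
  obtain ⟨ht5, htne, htn⟩ := mem_stdSphere.1 ht
  have hlt : ∀ j ∈ A, j < 5 := fun j hj => Finset.mem_range.1 (hA5.1 hj)
  have hA5n : 5 ∉ A := fun h => by have := hlt 5 h; omega
  have hc : (0 : ℝ) < A.card := by exact_mod_cast hA.card_pos
  set μ := A.inf' hA w with hμ
  have hμ0 : 0 ≤ μ := Finset.le_inf' _ _ fun j _ => hw.1 j
  have hμle : ∀ j ∈ A, μ ≤ w j := fun j hj => Finset.inf'_le w hj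
  obtain ⟨a, haA, hamin⟩ := Finset.exists_mem_eq_inf' hA w
  obtain ⟨b, hb5, hbt⟩ : ∃ b ∈ Finset.range 5, b ∉ t := by
    by_contra hcon
    push Not at hcon
    exact htn (Finset.Subset.antisymm ht5 hcon)
  have hwb : w b = 0 := hw.2.1 b hbt
  set W := fcoord A hA w with hW
  have hW0 : ∀ v, 0 ≤ W v := by
    intro v
    simp only [hW, fcoord]
    split_ifs with h1 h2 h3
    · exact mul_nonneg hc.le hμ0
    · have := hμle v h2; linarith
    · exact hw.1 v
    · exact le_rfl
  have hWa : W a = 0 := by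
    have : a ≠ 5 := by have := hlt a haA; omega
    simp [hW, fcoord, this, haA, hamin]
  have hW5 : W 5 = A.card * μ := by simp [hW, fcoord, hμ]
  have hWA : ∀ v ∈ A, W v = w v - μ := by
    intro v hv
    have : v ≠ 5 := by have := hlt v hv; omega
    simp [hW, fcoord, this, hv, hμ]
  have hWB : ∀ v, v < 5 → v ∉ A → W v = w v := by
    intro v hv hv'
    have : v ≠ 5 := by omega
    simp [hW, fcoord, this, hv, hv']
  have hW6 : ∀ v, ¬ v < 6 → W v = 0 := by
    intro v hv
    have h1 : v ≠ 5 := by omega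
    have h2 : v ∉ A := fun h => by have := hlt v h; omega
    have h3 : ¬ v < 5 := by omega
    simp [hW, fcoord, h1, h2, h3]
  set s := (Finset.range 6).filter (fun v => W v ≠ 0) with hs
  have hWs : ∀ i, i ∉ s → W i = 0 := by
    intro i hi
    by_contra hne
    apply hi
    refine Finset.mem_filter.2 ⟨Finset.mem_range.2 ?_, hne⟩
    by_contra h
    exact hne (hW6 i h)
  have hs6 : s ⊆ Finset.range 6 := Finset.filter_subset _ _
  have hcomb : ∑ i ∈ s, W i • fpos A i = w := by
    funext j
    rw [comb_eq A s hs6 W hWs, hW5]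
    by_cases hjA : j ∈ A
    · rw [if_pos (hlt j hjA), if_pos hjA, hWA j hjA]
      field_simp
      ring
    · by_cases hj : j < 5
      · rw [if_pos hj, if_neg hjA, hWB j hj hjA]; ring
      · rw [if_neg hj, if_neg hjA, hw.2.1 j (fun h => hj (Finset.mem_range.1 (ht5 h)))]; ring
  have hsum : ∑ i ∈ s, W i = 1 := by
    have h1 : ∑ i ∈ Finset.range 5, w i = 1 := by
      rw [← hw.2.2]
      exact (Finset.sum_subset ht5 (fun i _ hi => hw.2.1 i hi)).symm
    rw [Finset.sum_subset hs6 (fun i _ hi => hWs i hi), Finset.sum_range_succ, hW5]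
    have h2 : ∀ i ∈ Finset.range 5, W i = w i - if i ∈ A then μ else 0 := by
      intro i hi
      split_ifs with h
      · exact hWA i h
      · rw [hWB i (Finset.mem_range.1 hi) h]; ring
    rw [Finset.sum_congr rfl h2, Finset.sum_sub_distrib, h1, Finset.sum_ite_mem,
      Finset.inter_eq_right.2 hA5.1]
    simp
  have hweight : IsWeight s W := ⟨hW0, hWs, hsum⟩
  refine ⟨s, mem_bjoin.2 ⟨?_, ?_, ?_, ?_⟩, ?_⟩
  · intro v hv
    by_cases h : v ∈ A
    · exact Finset.mem_union_left _ h
    · exact Finset.mem_union_right _ (Finset.mem_sdiff.2 ⟨hs6 hv, h⟩)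
  · by_contra hemp
    rw [Finset.not_nonempty_iff_eq_empty] at hemp
    rw [hemp] at hsum
    simp at hsum
  · intro h
    exact (Finset.mem_filter.1 (h haA)).2 hWa
  · intro h
    by_cases hbA : b ∈ A
    · have h1 := hμle b hbA
      have hμz : μ = 0 := by linarith
      have : (5 : ℕ) ∈ s := h (Finset.mem_sdiff.2 ⟨by simp, hA5n⟩)
      apply (Finset.mem_filter.1 this).2
      rw [hW5, hμz, mul_zero]
    · have hb := Finset.mem_range.1 hb5
      have : b ∈ s := h (Finset.mem_sdiff.2 ⟨Finset.mem_range.2 (by omega), hbA⟩)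
      apply (Finset.mem_filter.1 this).2
      rw [hWB b hb hbA, hwb]
  · have := hull_of_weight (f := fpos A) hweight
    rwa [hcomb] at this

theorem subdivides_refl (G : GComplex) : Subdivides G G :=
  ⟨rfl, fun s hs => ⟨s, hs, subset_rfl⟩⟩

theorem iso_refl (K : Finset (Finset V)) : Iso K K :=
  ⟨id, Set.injOn_id _, by
    have h : (Finset.image (id : V → V)) = id := funext fun s => Finset.image_id
    rw [h, Finset.image_id]⟩

/-- A join of boundaries with any vertex labels is a combinatorial 3-sphere. -/
theorem bjoin_sphere (A B : Finset V) (hA : A.Nonempty) (hB : 2 ≤ B.card)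
    (hAB : Disjoint A B) (h6 : (A ∪ B).card = 6) : IsCombSphere 3 (bjoin A B) := by
  obtain ⟨c, hc⟩ : B.Nonempty := Finset.card_pos.1 (by omega)
  have hcA : c ∉ A := fun h => Finset.disjoint_left.1 hAB h hc
  have hcU : c ∈ A ∪ B := Finset.mem_union_right _ hc
  have hcard : ((A ∪ B).erase c).card = 5 := by rw [Finset.card_erase_of_mem hcU, h6]
  let e : ((A ∪ B).erase c) ≃ Fin 5 := Finset.equivFinOfCardEq hcard
  let g : V → ℕ := fun v => if h : v ∈ (A ∪ B).erase c then (e ⟨v, h⟩ : ℕ) else 5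
  have hg5 : ∀ v ∈ (A ∪ B).erase c, g v < 5 := by
    intro v hv
    simp only [g, hv, dif_pos]
    exact (e ⟨v, hv⟩).2
  have hgc : g c = 5 := by simp [g]
  have hginj : Set.InjOn g ↑(A ∪ B) := by
    intro u hu v hv huv
    have hu : u ∈ A ∪ B := hu
    have hv : v ∈ A ∪ B := hv
    by_cases huc : u = c
    · by_cases hvc : v = c
      · rw [huc, hvc]
      · have := hg5 v (Finset.mem_erase.2 ⟨hvc, hv⟩)
        rw [← huv, huc, hgc] at this
        omega
    · have hu' := Finset.mem_erase.2 ⟨huc, hu⟩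
      by_cases hvc : v = c
      · have := hg5 u hu'
        rw [huv, hvc, hgc] at this
        omega
      · have hv' := Finset.mem_erase.2 ⟨hvc, hv⟩
        simp only [g, hu', hv', dif_pos] at huv
        have := e.injective (Fin.ext huv)
        exact congrArg Subtype.val this
  set A' : Finset ℕ := A.image g with hA'
  have hA'ne : A'.Nonempty := hA.image g
  have himg : (A ∪ B).image g = Finset.range 6 := by
    apply Finset.eq_of_subset_of_card_le
    · intro j hj
      obtain ⟨v, hv, rfl⟩ := Finset.mem_image.1 hj
      apply Finset.mem_range.2
      by_cases hvc : v = c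
      · rw [hvc, hgc]; norm_num
      · have := hg5 v (Finset.mem_erase.2 ⟨hvc, hv⟩); omega
    · rw [Finset.card_image_of_injOn hginj, h6]; simp
  have hA5 : A' ⊂ Finset.range 5 := by
    have hsub : A' ⊆ Finset.range 5 := by
      intro j hj
      obtain ⟨v, hv, rfl⟩ := Finset.mem_image.1 hj
      apply Finset.mem_range.2
      apply hg5
      exact Finset.mem_erase.2 ⟨fun h => hcA (h ▸ hv), Finset.mem_union_left _ hv⟩
    refine Finset.ssubset_iff_subset_ne.2 ⟨hsub, fun h => ?_⟩
    have h1 : A'.card ≤ A.card := Finset.card_image_le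
    rw [h, Finset.card_range] at h1
    rw [Finset.card_union_of_disjoint hAB] at h6
    omega
  have hAU : A ⊆ A ∪ B := Finset.subset_union_left
  have hBU : B ⊆ A ∪ B := Finset.subset_union_right
  have hgsub : ∀ s t : Finset V, s ⊆ A ∪ B → t ⊆ A ∪ B → (s.image g ⊆ t.image g ↔ s ⊆ t) := by
    intro s t hs ht
    refine ⟨fun h v hv => ?_, Finset.image_subset_image⟩
    obtain ⟨u, hu, huv⟩ := Finset.mem_image.1 (h (Finset.mem_image_of_mem g hv))
    have := hginj (ht hu) (hs hv) huv
    exact this ▸ hu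
  have hB' : B.image g = Finset.range 6 \ A' := by
    ext j
    rw [← himg, Finset.mem_sdiff]
    constructor
    · intro hj
      obtain ⟨v, hv, rfl⟩ := Finset.mem_image.1 hj
      refine ⟨Finset.mem_image_of_mem g (hBU hv), fun h => ?_⟩
      obtain ⟨u, hu, huv⟩ := Finset.mem_image.1 h
      have := hginj (hAU hu) (hBU hv) huv
      exact Finset.disjoint_left.1 hAB hu (this ▸ hv)
    · rintro ⟨hj, hjA⟩
      obtain ⟨v, hv, rfl⟩ := Finset.mem_image.1 hj
      rcases Finset.mem_union.1 hv with h | h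
      · exact absurd (Finset.mem_image_of_mem g h) hjA
      · exact Finset.mem_image_of_mem g h
  have hJ : bjoin A' (Finset.range 6 \ A') = (bjoin A B).image (Finset.image g) := by
    rw [← hB']
    ext s
    rw [Finset.mem_image, mem_bjoin, ← Finset.image_union]
    constructor
    · rintro ⟨h1, h2, h3, h4⟩
      obtain ⟨t, ht, rfl⟩ := Finset.subset_image_iff.1 h1
      have ht : t ⊆ A ∪ B := by exact_mod_cast ht
      rw [hgsub A t hAU ht] at h3
      rw [hgsub B t hBU ht] at h4
      exact ⟨t, mem_bjoin.2 ⟨ht, Finset.image_nonempty.1 h2, h3, h4⟩, rfl⟩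
    · rintro ⟨t, ht, rfl⟩
      obtain ⟨h1, h2, h3, h4⟩ := mem_bjoin.1 ht
      rw [hgsub A t hAU h1, hgsub B t hBU h1]
      exact ⟨Finset.image_subset_image h1, h2.image g, h3, h4⟩
  have hd : Disjoint A' (Finset.range 6 \ A') := Finset.disjoint_sdiff
  have hB2 : 2 ≤ (Finset.range 6 \ A').card := by
    have h1 : A'.card < 5 := by simpa using Finset.card_lt_card hA5
    have h2 := Finset.le_card_sdiff A' (Finset.range 6)
    rw [Finset.card_range] at h2
    omega
  have hcx := bjoin_isComplex hA'ne hB2 hd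
  have hcx' : IsComplex (stdSphere (Finset.range 5)) := stdSphere_isComplex (by simp)
  let G1 := mkG _ hcx _ _ (fcoord_ok A' hA'ne hA5.1)
  let G2 := mkG _ hcx' _ _ spos_ok
  have hr1 := mkG_realizes _ hcx _ _ (fcoord_ok A' hA'ne hA5.1)
  have hr2 := mkG_realizes _ hcx' _ _ spos_ok
  refine ⟨Finset.range 5, by simp, G1, G1, G2, G1, ?_, ⟨_, hr2⟩, subdivides_refl _, ?_, iso_refl _⟩
  · have hvU : verts (bjoin A B) ⊆ A ∪ B := by
      intro v hv
      obtain ⟨s, hs, hvs⟩ := mem_verts.1 hv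
      exact (mem_bjoin.1 hs).1 hvs
    refine ⟨fun v => fpos A' (g v), ?_, ?_⟩
    · intro u hu v hv huv
      apply hginj (hvU hu) (hvU hv)
      have hmem : ∀ u ∈ verts (bjoin A B), g u ∈ verts (bjoin A' (Finset.range 6 \ A')) := by
        intro u hu
        obtain ⟨s, hs, hvs⟩ := mem_verts.1 hu
        rw [hJ]
        exact mem_verts.2 ⟨_, Finset.mem_image_of_mem _ hs, Finset.mem_image_of_mem g hvs⟩
      exact hr1.1 (hmem u hu) (hmem v hv) huv
    · have := hr1.2
      refine this.trans ?_
      rw [hJ, Finset.image_image]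
      congr 1
      funext s
      simp [Finset.image_image, Function.comp_def]
  · constructor
    · ext x
      rw [mkG_carrier, mkG_carrier]
      constructor
      · rintro ⟨s, hs, hx⟩
        obtain ⟨t, ht, hst⟩ := sub_face A' hA'ne hA5 s hs
        exact ⟨t, ht, hst hx⟩
      · rintro ⟨t, ht, hx⟩
        exact sup_face A' hA'ne hA5 t ht x hx
    · intro y hy
      obtain ⟨s, hs, rfl⟩ := Finset.mem_image.1 hy
      obtain ⟨t, ht, hst⟩ := sub_face A' hA'ne hA5 s hs
      exact ⟨t.image spos, Finset.mem_image_of_mem _ ht, hst⟩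

theorem stdSphere_sphere (U : Finset V) (h5 : U.card = 5) : IsCombSphere 3 (stdSphere U) := by
  let e : U ≃ Fin 5 := Finset.equivFinOfCardEq h5
  let g : V → ℕ := fun v => if h : v ∈ U then (e ⟨v, h⟩ : ℕ) else 5
  have hginj : Set.InjOn g ↑U := by
    intro u hu v hv huv
    have hu : u ∈ U := hu
    have hv : v ∈ U := hv
    simp only [g, hu, hv, dif_pos] at huv
    exact congrArg Subtype.val (e.injective (Fin.ext huv))
  have himg : U.image g = Finset.range 5 := by
    apply Finset.eq_of_subset_of_card_le
    · intro j hj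
      obtain ⟨v, hv, rfl⟩ := Finset.mem_image.1 hj
      apply Finset.mem_range.2
      simp only [g, hv, dif_pos]
      exact (e ⟨v, hv⟩).2
    · rw [Finset.card_image_of_injOn hginj, h5]; simp
  have hJ : stdSphere (Finset.range 5) = (stdSphere U).image (Finset.image g) := by
    rw [← himg]
    ext s
    rw [Finset.mem_image, mem_stdSphere]
    constructor
    · rintro ⟨h1, h2, h3⟩
      obtain ⟨t, ht, rfl⟩ := Finset.subset_image_iff.1 h1
      have ht : t ⊆ U := by exact_mod_cast ht
      exact ⟨t, mem_stdSphere.2 ⟨ht, Finset.image_nonempty.1 h2, fun h => h3 (by rw [h])⟩, rfl⟩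
    · rintro ⟨t, ht, rfl⟩
      obtain ⟨h1, h2, h3⟩ := mem_stdSphere.1 ht
      refine ⟨Finset.image_subset_image h1, h2.image g, fun h => h3 ?_⟩
      apply Finset.eq_of_subset_of_card_le h1
      rw [← Finset.card_image_of_injOn hginj, ← h]
      exact Finset.card_image_le
  have hcx' : IsComplex (stdSphere (Finset.range 5)) := stdSphere_isComplex (by simp)
  let G2 := mkG _ hcx' _ _ spos_ok
  have hr2 := mkG_realizes _ hcx' _ _ spos_ok
  refine ⟨Finset.range 5, by simp, G2, G2, G2, G2, ?_, ⟨_, hr2⟩, subdivides_refl _,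
    subdivides_refl _, iso_refl _⟩
  have hvU : verts (stdSphere U) ⊆ U := by
    intro v hv
    obtain ⟨s, hs, hvs⟩ := mem_verts.1 hv
    exact (mem_stdSphere.1 hs).1 hvs
  refine ⟨fun v => spos (g v), ?_, ?_⟩
  · intro u hu v hv huv
    exact hginj (hvU hu) (hvU hv) (spos_inj huv)
  · refine hr2.2.trans ?_
    rw [hJ, Finset.image_image]
    congr 1
    funext s
    simp [Finset.image_image, Function.comp_def]

theorem bjoin_comm (A B : Finset V) : bjoin A B = bjoin B A := by
  ext s
  rw [mem_bjoin, mem_bjoin, Finset.union_comm]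
  tauto

theorem second_tet {K : Finset (Finset V)} (hK : IsComplex K)
    (hdeg : ∀ s ∈ K, s.card = 3 → 2 ≤ degOf K 3 s) {t : Finset V} (ht : t ∈ K)
    (ht4 : t.card = 4) {z : V} (hz : z ∈ t) :
    ∃ v ∈ verts K, v ∉ t ∧ insert v (t.erase z) ∈ K := by
  have h3 : (t.erase z).card = 3 := by rw [Finset.card_erase_of_mem hz, ht4]
  have hK3 : t.erase z ∈ K :=
    hK.2.2 t ht _ (Finset.erase_subset _ _) (Finset.card_pos.1 (by omega))
  have hd := hdeg _ hK3 h3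
  unfold degOf at hd
  obtain ⟨t', ht', hne⟩ := Finset.exists_mem_ne (Nat.lt_of_succ_le hd) t
  obtain ⟨ht'K, hsub, h4⟩ := Finset.mem_filter.1 ht'
  obtain ⟨v, hv, hveq⟩ : ∃ v, v ∉ t.erase z ∧ insert v (t.erase z) = t' := by
    have : (t' \ t.erase z).card = 1 := by
      rw [Finset.card_sdiff_of_subset hsub, h4, h3]
    obtain ⟨v, hv⟩ := Finset.card_eq_one.1 this
    refine ⟨v, ?_, ?_⟩
    · have : v ∈ t' \ t.erase z := by rw [hv]; simp
      exact (Finset.mem_sdiff.1 this).2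
    · rw [Finset.insert_eq, ← hv, Finset.sdiff_union_of_subset hsub]
  refine ⟨v, mem_verts.2 ⟨t', ht'K, ?_⟩, ?_, ?_⟩
  · rw [← hveq]; exact Finset.mem_insert_self _ _
  · intro hvt
    have : v = z := by
      by_contra h
      exact hv (Finset.mem_erase.2 ⟨h, hvt⟩)
    rw [this, Finset.insert_erase hz] at hveq
    exact hne hveq.symm
  · rw [hveq]; exact ht'K

/-- a 3-dimensional simplicial complex on at most 6 vertices with
at least two tetrahedra through each triangle contains a combinatorial 3-sphere
as a subcomplex. -/
theorem six_vertex_three_dim_contains_sphere {V : Type*} [DecidableEq V]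
    (K : Finset (Finset V)) (hK : IsComplex K)
    (hdim : K.sup Finset.card = 4) (h6 : (verts K).card ≤ 6)
    (hdeg : ∀ s ∈ K, s.card = 3 → 2 ≤ degOf K 3 s) :
    ∃ S : Finset (Finset V), S ⊆ K ∧ IsComplex S ∧ IsCombSphere 3 S := by
  obtain ⟨σ, hσ, hσ4⟩ := Finset.exists_mem_eq_sup K hK.1 Finset.card
  rw [hdim] at hσ4
  have hσ4 : σ.card = 4 := hσ4.symm
  set U := verts K with hU
  have hsubU : ∀ s ∈ K, s ⊆ U := fun s hs v hv => mem_verts.2 ⟨s, hs, hv⟩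
  have hσU := hsubU σ hσ
  obtain ⟨z, hz⟩ : σ.Nonempty := Finset.card_pos.1 (by omega)
  obtain ⟨x, hxU, hxσ, -⟩ := second_tet hK hdeg hσ hσ4 hz
  have h5 : (insert x σ).card = 5 := by rw [Finset.card_insert_of_notMem hxσ, hσ4]
  have h5U : insert x σ ⊆ U := Finset.insert_subset hxU hσU
  have hcases : U.card = 5 ∨ U.card = 6 := by
    have := Finset.card_le_card h5U
    omega
  rcases hcases with hc | hc
  · -- five vertices: all tetrahedra are present
    have hUeq : insert x σ = U := Finset.eq_of_subset_of_card_le h5U (by omega)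
    have htet : ∀ y ∈ U, U.erase y ∈ K := by
      intro y hy
      by_cases hyx : y = x
      · rw [hyx, ← hUeq, Finset.erase_insert hxσ]; exact hσ
      · have hyσ : y ∈ σ := by
          rw [← hUeq] at hy
          exact (Finset.mem_insert.1 hy).resolve_left hyx
        obtain ⟨v, hvU, hvσ, hv⟩ := second_tet hK hdeg hσ hσ4 hyσ
        have hvx : v = x := by
          have : v ∈ insert x σ := by rw [hUeq]; exact hvU
          exact (Finset.mem_insert.1 this).resolve_right hvσ
        rw [hvx] at hv
        rw [← hUeq, Finset.erase_insert_of_ne (Ne.symm hyx)]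
        exact hv
    refine ⟨stdSphere U, ?_, stdSphere_isComplex (by omega), stdSphere_sphere U hc⟩
    intro s hs
    obtain ⟨h1, h2, h3⟩ := mem_stdSphere.1 hs
    obtain ⟨y, hyU, hys⟩ : ∃ y ∈ U, y ∉ s := by
      by_contra hcon
      push Not at hcon
      exact h3 (Finset.Subset.antisymm h1 hcon)
    refine hK.2.2 _ (htet y hyU) s ?_ h2
    intro v hv
    exact Finset.mem_erase.2 ⟨fun h => hys (h ▸ hv), h1 hv⟩
  · -- six vertices
    obtain ⟨y, hyU, hyn⟩ : ∃ y ∈ U, y ∉ insert x σ := by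
      by_contra hcon
      push Not at hcon
      have := Finset.card_le_card (show U ⊆ insert x σ from hcon)
      omega
    have hyx : y ≠ x := fun h => hyn (h ▸ Finset.mem_insert_self _ _)
    have hyσ : y ∉ σ := fun h => hyn (Finset.mem_insert_of_mem h)
    have hcard : ∀ a ∈ U, ∀ b ∈ U, a ≠ b → (U \ {a, b}).card = 4 := by
      intro a ha b hb hab
      rw [Finset.card_sdiff_of_subset, hc, Finset.card_pair hab]
      intro v hv
      rcases Finset.mem_insert.1 hv with h | h
      · exact h ▸ ha
      · exact (Finset.mem_singleton.1 h) ▸ hb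
    have hσeq : U \ {x, y} = σ := by
      symm
      apply Finset.eq_of_subset_of_card_le
      · intro v hv
        refine Finset.mem_sdiff.2 ⟨hσU hv, fun h => ?_⟩
        rcases Finset.mem_insert.1 h with h | h
        · exact hxσ (h ▸ hv)
        · exact hyσ ((Finset.mem_singleton.1 h) ▸ hv)
      · rw [hcard x hxU y hyU (Ne.symm hyx), hσ4]
    set A := U.filter (fun v => v = x ∨ U \ {x, v} ∉ K) with hA
    set B := U.filter (fun v => ¬ (v = x ∨ U \ {x, v} ∉ K)) with hB
    have hxA : x ∈ A := Finset.mem_filter.2 ⟨hxU, Or.inl rfl⟩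
    have hyB : y ∈ B := by
      refine Finset.mem_filter.2 ⟨hyU, ?_⟩
      push Not
      exact ⟨hyx, by rw [hσeq]; exact hσ⟩
    have hABd : Disjoint A B := Finset.disjoint_filter_filter_not _ _ _
    have hABu : A ∪ B = U := Finset.filter_union_filter_not_eq _ _
    have htet : ∀ a ∈ A, ∀ b ∈ B, U \ {a, b} ∈ K := by
      intro a ha b hb
      obtain ⟨haU, ha'⟩ := Finset.mem_filter.1 ha
      obtain ⟨hbU, hb'⟩ := Finset.mem_filter.1 hb
      push Not at hb'
      rcases ha' with ha' | ha'
      · rw [ha']; exact hb'.2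
      by_cases hax : a = x
      · rw [hax]; exact hb'.2
      have hab : a ≠ b := fun h => Finset.disjoint_left.1 hABd ha (h ▸ hb)
      have hat : a ∈ U \ {x, b} := by simp [haU, hax, hab]
      obtain ⟨v, hvU, hvt, hv⟩ :=
        second_tet hK hdeg hb'.2 (hcard x hxU b hbU (Ne.symm hb'.1)) hat
      have hvU : v ∈ U := hvU
      have hv2 : v = x ∨ v = b := by
        by_contra hcon
        push Not at hcon
        exact hvt (by simp [hvU, hcon.1, hcon.2] : v ∈ U \ {x, b})
      rcases hv2 with rfl | rfl
      · convert hv using 1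
        ext w
        simp only [Finset.mem_sdiff, Finset.mem_insert, Finset.mem_singleton, Finset.mem_erase]
        by_cases hw : w = v
        · subst hw
          simp [hvU, Ne.symm hax, Ne.symm hb'.1]
        · simp [hw]; tauto
      · exfalso
        apply ha'
        convert hv using 1
        ext w
        simp only [Finset.mem_sdiff, Finset.mem_insert, Finset.mem_singleton, Finset.mem_erase]
        by_cases hw : w = v
        · subst hw
          simp [hvU, Ne.symm hab, hb'.1]
        · simp [hw]; tauto
    have hsubK : bjoin A B ⊆ K := by
      intro s hs
      obtain ⟨h1, h2, h3, h4⟩ := mem_bjoin.1 hs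
      obtain ⟨a, ha, has⟩ := Finset.not_subset.1 h3
      obtain ⟨b, hb, hbs⟩ := Finset.not_subset.1 h4
      refine hK.2.2 _ (htet a ha b hb) s ?_ h2
      intro v hv
      refine Finset.mem_sdiff.2 ⟨hABu ▸ h1 hv, fun h => ?_⟩
      rcases Finset.mem_insert.1 h with h | h
      · exact has (h ▸ hv)
      · exact hbs ((Finset.mem_singleton.1 h) ▸ hv)
    have hAB6 : (A ∪ B).card = 6 := by rw [hABu, hc]
    have hsum : A.card + B.card = 6 := by rw [← Finset.card_union_of_disjoint hABd, hAB6]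
    by_cases hB2 : 2 ≤ B.card
    · exact ⟨bjoin A B, hsubK, bjoin_isComplex ⟨x, hxA⟩ hB2 hABd,
        bjoin_sphere A B ⟨x, hxA⟩ hB2 hABd hAB6⟩
    · have hA2 : 2 ≤ A.card := by omega
      rw [bjoin_comm] at hsubK
      exact ⟨bjoin B A, hsubK, bjoin_isComplex ⟨y, hyB⟩ hA2 hABd.symm,
        bjoin_sphere B A ⟨y, hyB⟩ hA2 hABd.symm (by rw [Finset.union_comm]; exact hAB6)⟩

end HomologySpheres
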